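/- For any tiling system τ = (T, F), the set of slopes Sl_τ ⊆ ℚ ∪ {∞} is recursively enumerable: there is a Turing machine that, on input (p, q) ∈ ℤ² \ {(0,0)}, halts if and only if q/p ∈ Sl_τ. -/

import Mathlib

/-- A finite pattern: a finite support in `ℤ²` together with tile data. -/
structure Pattern (T : Type) where
  support : Finset (ℤ × ℤ)
  data : ℤ × ℤ → T

/-- A tiling system: a finite set of finite forbidden patterns over the tile set `T`. -/
structure TilingSystem (T : Type) where
  F : Set (Pattern T)
  finite : F.Finite

/-- A tiling is valid when no translate of a forbidden pattern appears in it. -/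
def TilingSystem.Valid {T : Type} (τ : TilingSystem T) (c : ℤ × ℤ → T) : Prop :=
  ∀ p ∈ τ.F, ∀ u : ℤ × ℤ, ∃ n ∈ p.support, c (n + u) ≠ p.data n

/-- A vector `v` is a period of the tiling `c`. -/
def IsPeriod {T : Type} (c : ℤ × ℤ → T) (v : ℤ × ℤ) : Prop :=
  ∀ x : ℤ × ℤ, c (x + v) = c x

/-- The direction of a vector of `ℤ²`, an element of `ℚ ∪ {∞}` modelled as `Option ℚ`
(`none` being `∞`, obtained when the first coordinate vanishes). -/
def dir (v : ℤ × ℤ) : Option ℚ :=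
  if v.1 = 0 then none else some ((v.2 : ℚ) / (v.1 : ℚ))

/-- A tiling has slope `θ` when it has a nonzero period and all its nonzero
periods have direction `θ`. -/
def HasSlope {T : Type} (c : ℤ × ℤ → T) (θ : Option ℚ) : Prop :=
  (∃ v : ℤ × ℤ, v ≠ 0 ∧ IsPeriod c v ∧ dir v = θ) ∧
    ∀ v : ℤ × ℤ, v ≠ 0 → IsPeriod c v → dir v = θ

/-- The set of slopes of all valid tilings of a tiling system. -/
def TilingSystem.Slopes {T : Type} (τ : TilingSystem T) : Set (Option ℚ) :=
  {θ : Option ℚ | ∃ c : ℤ × ℤ → T, τ.Valid c ∧ HasSlope c θ}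

namespace SlopesRE

theorem encode_int (z : ℤ) : Encodable.encode z = if 0 ≤ z then 2 * z.toNat else 2 * (-z).toNat - 1 := by
  change Equiv.intEquivNat z = _
  rcases z with n | n
  · simp [Equiv.intEquivNat, Equiv.intEquivNatSumNat]
    rfl
  · have : ¬ (0 ≤ Int.negSucc n) := by omega
    rw [if_neg this]
    simp [Equiv.intEquivNat, Equiv.intEquivNatSumNat]
    omega

theorem prim_toNat : Primrec (fun z : ℤ => z.toNat) := by
  refine (Primrec.ite (c := fun z : ℤ => Encodable.encode z % 2 = 0)
    (f := fun z : ℤ => Encodable.encode z / 2) (g := fun _ => 0) ?_ ?_ (Primrec.const 0)).of_eq ?_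
  · exact Primrec.eq.comp (Primrec.nat_mod.comp Primrec.encode (Primrec.const 2)) (Primrec.const 0)
  · exact Primrec.nat_div.comp Primrec.encode (Primrec.const 2)
  · intro z
    simp only [encode_int]
    split_ifs <;> omega

theorem prim_negToNat : Primrec (fun z : ℤ => (-z).toNat) := by
  refine (Primrec.ite (c := fun z : ℤ => Encodable.encode z % 2 = 0)
    (f := fun _ => 0) (g := fun z : ℤ => (Encodable.encode z + 1) / 2) ?_ (Primrec.const 0) ?_).of_eq ?_
  · exact Primrec.eq.comp (Primrec.nat_mod.comp Primrec.encode (Primrec.const 2)) (Primrec.const 0)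
  · exact Primrec.nat_div.comp (Primrec.succ.comp Primrec.encode) (Primrec.const 2)
  · intro z
    simp only [encode_int]
    split_ifs <;> omega

theorem prim_natSub : Primrec₂ (fun m n : ℕ => (m : ℤ) - n) := by
  refine Primrec.encode_iff.1 ?_
  refine (Primrec.ite (c := fun p : ℕ × ℕ => p.2 ≤ p.1)
    (f := fun p => 2 * (p.1 - p.2)) (g := fun p => 2 * (p.2 - p.1) - 1) ?_ ?_ ?_).of_eq ?_
  · exact Primrec.nat_le.comp Primrec.snd Primrec.fst
  · exact Primrec.nat_mul.comp (Primrec.const 2) (Primrec.nat_sub.comp Primrec.fst Primrec.snd)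
  · exact Primrec.nat_sub.comp (Primrec.nat_mul.comp (Primrec.const 2)
      (Primrec.nat_sub.comp Primrec.snd Primrec.fst)) (Primrec.const 1)
  · rintro ⟨m, n⟩
    simp only [encode_int]
    split_ifs <;> omega

theorem prim_ofNat : Primrec (fun n : ℕ => (n : ℤ)) :=
  (prim_natSub.comp Primrec.id (Primrec.const 0)).of_eq (by intro n; simp)

theorem prim_add : Primrec₂ (fun x y : ℤ => x + y) := by
  refine (prim_natSub.comp
    (Primrec.nat_add.comp (prim_toNat.comp Primrec.fst) (prim_toNat.comp Primrec.snd))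
    (Primrec.nat_add.comp (prim_negToNat.comp Primrec.fst) (prim_negToNat.comp Primrec.snd))).of_eq ?_
  rintro ⟨x, y⟩
  simp only []
  omega

theorem prim_sub : Primrec₂ (fun x y : ℤ => x - y) := by
  refine (prim_natSub.comp
    (Primrec.nat_add.comp (prim_toNat.comp Primrec.fst) (prim_negToNat.comp Primrec.snd))
    (Primrec.nat_add.comp (prim_negToNat.comp Primrec.fst) (prim_toNat.comp Primrec.snd))).of_eq ?_
  rintro ⟨x, y⟩
  simp only []
  omega

theorem prim_mul : Primrec₂ (fun x y : ℤ => x * y) := by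
  have f := prim_toNat.comp (Primrec.fst (α := ℤ) (β := ℤ))
  have g := prim_toNat.comp (Primrec.snd (α := ℤ) (β := ℤ))
  have f' := prim_negToNat.comp (Primrec.fst (α := ℤ) (β := ℤ))
  have g' := prim_negToNat.comp (Primrec.snd (α := ℤ) (β := ℤ))
  refine (prim_natSub.comp
    (Primrec.nat_add.comp (Primrec.nat_mul.comp f g) (Primrec.nat_mul.comp f' g'))
    (Primrec.nat_add.comp (Primrec.nat_mul.comp f g') (Primrec.nat_mul.comp f' g))).of_eq ?_
  rintro ⟨x, y⟩
  simp only []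
  have hx : x = x.toNat - (-x).toNat := by omega
  have hy : y = y.toNat - (-y).toNat := by omega
  conv_rhs => rw [hx, hy]
  push_cast
  ring

theorem prim_lt : PrimrecRel (fun x y : ℤ => x < y) := by
  refine PrimrecPred.of_eq (Primrec.nat_lt.comp
    (Primrec.nat_add.comp (prim_toNat.comp Primrec.fst) (prim_negToNat.comp Primrec.snd))
    (Primrec.nat_add.comp (prim_negToNat.comp Primrec.fst) (prim_toNat.comp Primrec.snd))) ?_
  rintro ⟨x, y⟩
  simp only []
  omega

theorem prim_emod : Primrec₂ (fun (x : ℤ) (n : ℕ) => x % (n : ℤ)) := by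
  have f := prim_toNat.comp (Primrec.fst (α := ℤ) (β := ℕ))
  have f' := prim_negToNat.comp (Primrec.fst (α := ℤ) (β := ℕ))
  refine (Primrec.ite (c := fun p : ℤ × ℕ => p.2 = 0) (f := fun p => p.1)
    (g := fun p => (((p.1.toNat + p.2 * (-p.1).toNat - (-p.1).toNat) % p.2 : ℕ) : ℤ)) ?_ ?_ ?_).of_eq ?_
  · exact Primrec.eq.comp Primrec.snd (Primrec.const 0)
  · exact Primrec.fst
  · exact prim_ofNat.comp (Primrec.nat_mod.comp (Primrec.nat_sub.comp (Primrec.nat_add.comp f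
      (Primrec.nat_mul.comp Primrec.snd f')) f') Primrec.snd)
  · rintro ⟨x, n⟩
    simp only []
    split_ifs with h
    · simp [h]
    · have h1 : (-x).toNat ≤ n * (-x).toNat := Nat.le_mul_of_pos_left _ (by omega)
      rw [Int.natCast_emod, Nat.cast_sub (by omega)]
      push_cast
      have : (x.toNat : ℤ) + n * (-x).toNat - (-x).toNat = x + n * (-x).toNat := by
        have : (x.toNat : ℤ) - (-x).toNat = x := by omega
        linarith
      rw [this, Int.add_mul_emod_self_left]

/-- Existential projection of a primitive recursive relation is r.e. -/
theorem re_exists {α β : Type} [Primcodable α] [Primcodable β] {R : α → β → Prop}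
    (hR : PrimrecRel R) : ∃ f : α →. Unit, Partrec f ∧ ∀ a, (f a).Dom ↔ ∃ b, R a b := by
  classical
  let g : α → ℕ → Option Unit := fun a n =>
    (Encodable.decode (α := β) n).bind fun b => if R a b then some () else none
  have hg : Primrec₂ g := by
    refine Primrec.option_bind (Primrec.decode.comp Primrec.snd) ?_
    refine Primrec.ite ?_ (Primrec.const _) (Primrec.const _)
    exact hR.comp (Primrec.fst.comp Primrec.fst) Primrec.snd
  refine ⟨fun a => Nat.rfindOpt (g a), Partrec.rfindOpt hg.to_comp, fun a => ?_⟩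
  rw [Nat.rfindOpt_dom]
  constructor
  · rintro ⟨n, u, h⟩
    simp only [g, Option.mem_def, Option.bind_eq_some_iff] at h
    obtain ⟨b, hb, h⟩ := h
    refine ⟨b, ?_⟩
    by_contra hn
    simp [hn] at h
  · rintro ⟨b, hb⟩
    refine ⟨Encodable.encode b, (), ?_⟩
    simp [g, hb]

end SlopesRE
namespace SlopesRE

def hh (a b : ℤ) (z : ℤ × ℤ) : ℤ := a * z.2 - b * z.1

theorem hh_add (a b : ℤ) (z z' : ℤ × ℤ) : hh a b (z + z') = hh a b z + hh a b z' := by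
  simp only [hh, Prod.fst_add, Prod.snd_add]; ring

theorem hh_vert (a b t : ℤ) : hh a b (0, t) = a * t := by
  simp [hh]

theorem hh_w (a b : ℤ) : hh a b (a, b) = 0 := by
  simp only [hh]; ring

theorem IsPeriod.zmul {T : Type} {c : ℤ × ℤ → T} {v : ℤ × ℤ} (h : IsPeriod c v) (k : ℤ) :
    IsPeriod c (k * v.1, k * v.2) := by
  induction k using Int.induction_on with
  | zero =>
    intro x
    congr 1
    ext <;> simp
  | succ n ih =>
    intro x
    rw [← ih x, ← h (x + ((n : ℤ) * v.1, (n : ℤ) * v.2))]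
    congr 1
    ext <;> simp <;> ring
  | pred n ih =>
    intro x
    rw [← ih x, ← h (x + _)]
    congr 1
    ext <;> simp <;> ring

theorem IsPeriod.add {T : Type} {c : ℤ × ℤ → T} {v v' : ℤ × ℤ} (h : IsPeriod c v)
    (h' : IsPeriod c v') : IsPeriod c (v + v') := by
  intro x
  rw [← add_assoc, h', h]

theorem eq_of_class {T : Type} {c : ℤ × ℤ → T} {a b : ℤ} (ha : 0 < a) (h : IsPeriod c (a, b))
    {z z' : ℤ × ℤ} (h1 : z.1 % a = z'.1 % a) (h2 : hh a b z = hh a b z') : c z = c z' := by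
  obtain ⟨k, hk⟩ := (Int.ModEq.dvd (show z'.1 ≡ z.1 [ZMOD a] from h1.symm) : a ∣ z.1 - z'.1)
  have h3 : z.2 - z'.2 = k * b := by
    have : a * (z.2 - z'.2) = a * (k * b) := by
      simp only [hh] at h2
      have : a * (z.2 - z'.2) = b * (z.1 - z'.1) := by linarith
      rw [this, hk]; ring
    exact Int.eq_of_mul_eq_mul_left ha.ne' this
  rw [← IsPeriod.zmul h k z']
  congr 1
  ext
  · simp; linarith
  · simp; linarith

/-- slope characterisation -/
theorem slope_iff {T : Type} (τ : TilingSystem T) (p : ℤ × ℤ) (hp : p.1 ≠ 0) :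
    dir p ∈ τ.Slopes ↔ ∃ (a : ℕ) (b : ℤ), 0 < a ∧ b * p.1 = p.2 * a ∧
      ∃ c : ℤ × ℤ → T, τ.Valid c ∧ IsPeriod c (a, b) ∧ ∀ m : ℤ, m ≠ 0 → ¬ IsPeriod c (0, m) := by
  have hd : dir p = some ((p.2 : ℚ) / p.1) := by simp [dir, hp]
  have hpq : (p.1 : ℚ) ≠ 0 := by exact_mod_cast hp
  constructor
  · rintro ⟨c, hc, ⟨v, hv0, hv, hvd⟩, hall⟩
    have hv1 : v.1 ≠ 0 := by
      intro h
      rw [hd] at hvd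
      simp [dir, h] at hvd
    have hvq : (v.1 : ℚ) ≠ 0 := by exact_mod_cast hv1
    have hrel : v.2 * p.1 = p.2 * v.1 := by
      rw [hd] at hvd
      simp only [dir, hv1, if_false, Option.some.injEq] at hvd
      rw [div_eq_div_iff hvq hpq] at hvd
      exact_mod_cast hvd
    refine ⟨v.1.natAbs, v.1.sign * v.2, by omega, ?_, c, hc, ?_, ?_⟩
    · rw [← Int.sign_mul_self_eq_natAbs]
      linear_combination v.1.sign * hrel
    · have := IsPeriod.zmul hv v.1.sign
      rwa [Int.sign_mul_self_eq_natAbs] at this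
    · intro m hm hper
      have := hall (0, m) (by simpa using hm) hper
      rw [hd] at this
      simp [dir] at this
  · rintro ⟨a, b, ha, hab, c, hc, hper, hno⟩
    have ha' : (a : ℤ) ≠ 0 := by omega
    have haq : (a : ℚ) ≠ 0 := by exact_mod_cast ha'
    have hdab : dir ((a : ℤ), b) = dir p := by
      rw [hd]
      simp only [dir, ha', if_false, Option.some.injEq]
      rw [div_eq_div_iff (by exact_mod_cast ha') hpq]
      exact_mod_cast hab
    refine ⟨c, hc, ⟨((a : ℤ), b), ?_, hper, hdab⟩, ?_⟩
    · intro h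
      exact ha' (congrArg Prod.fst h)
    · rintro ⟨s, t⟩ hv0 hv
      have h1 : IsPeriod c (0, a * t - s * b) := by
        have := IsPeriod.add (IsPeriod.zmul hv a) (IsPeriod.zmul hper (-s))
        convert this using 1
        ext <;> simp <;> ring
      have h2 : (a : ℤ) * t - s * b = 0 := by
        by_contra h
        exact hno _ h h1
      have hs : s ≠ 0 := by
        rintro rfl
        have : t = 0 := by
          simpa [ha.ne'] using h2
        exact hv0 (by simp [this])
      rw [← hdab]
      have hsq : (s : ℚ) ≠ 0 := by exact_mod_cast hs
      simp only [dir, ha', hs, if_false, Option.some.injEq]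
      rw [div_eq_div_iff hsq (by exact_mod_cast ha')]
      have : t * a = b * s := by linarith
      exact_mod_cast this

theorem splice_valid {T : Type} (τ : TilingSystem T) {a b ρ : ℤ}
    (hρ : ∀ P ∈ τ.F, ∀ n ∈ P.support, |hh a b n| ≤ ρ) {c1 c2 : ℤ × ℤ → T}
    (h1 : τ.Valid c1) (h2 : τ.Valid c2) (e : ℤ)
    (hag : ∀ z, e - ρ ≤ hh a b z → hh a b z ≤ e + ρ → c1 z = c2 z) :
    τ.Valid (fun z => if hh a b z < e then c1 z else c2 z) := by
  intro P hP u
  by_cases hu : hh a b u < e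
  · obtain ⟨n, hn, hne⟩ := h1 P hP u
    refine ⟨n, hn, ?_⟩
    have := abs_le.1 (hρ P hP n hn)
    have hadd := hh_add a b n u
    simp only
    split_ifs with h
    · exact hne
    · rwa [← hag _ (by linarith) (by linarith)]
  · obtain ⟨n, hn, hne⟩ := h2 P hP u
    refine ⟨n, hn, ?_⟩
    have := abs_le.1 (hρ P hP n hn)
    have hadd := hh_add a b n u
    simp only
    split_ifs with h
    · rwa [hag _ (by linarith) (by linarith)]
    · exact hne

/-- periodic extension of the rows between `i` and `i+P` -/
def per {T : Type} (c : ℤ × ℤ → T) (a b i P : ℤ) (z : ℤ × ℤ) : T :=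
  c (z + (0, - (P * ((hh a b z - a * i) / (a * P)))))

theorem per_w {T : Type} {c : ℤ × ℤ → T} {a b : ℤ} (i P : ℤ) (h : IsPeriod c (a, b)) :
    IsPeriod (per c a b i P) (a, b) := by
  intro z
  simp only [per, hh_add, hh_w, add_zero]
  rw [add_right_comm, h]

theorem per_vert {T : Type} (c : ℤ × ℤ → T) {a b i P : ℤ} (ha : 0 < a) (hP : 0 < P) (m : ℤ)
    (z : ℤ × ℤ) : per c a b i P (z + (0, P * m)) = per c a b i P z := by
  have hne : a * P ≠ 0 := (mul_pos ha hP).ne'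
  simp only [per, hh_add, hh_vert]
  have : (hh a b z + a * (P * m) - a * i) / (a * P) = (hh a b z - a * i) / (a * P) + m := by
    rw [← Int.add_mul_ediv_left _ _ hne]
    congr 1; ring
  rw [this]
  congr 1
  ext <;> simp <;> ring

def Agree {T : Type} (c : ℤ × ℤ → T) (a b ρ i j : ℤ) : Prop :=
  ∀ z, |hh a b z| ≤ ρ → c (z + (0, i)) = c (z + (0, j))

theorem per_eq {T : Type} {c : ℤ × ℤ → T} {a b i P ρ : ℤ} (ha : 0 < a) (hP : ρ < P) (hρ : 0 ≤ ρ)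
    (hag : Agree c a b ρ i (i + P)) (z : ℤ × ℤ) (h1 : a * i - ρ ≤ hh a b z)
    (h2 : hh a b z ≤ a * (i + P) + ρ) : per c a b i P z = c z := by
  have hP0 : 0 < P := by linarith
  have haP : 0 < a * P := mul_pos ha hP0
  have hle : P ≤ a * P := by nlinarith
  rcases lt_or_ge (hh a b z) (a * i) with h | h
  · have hq : (hh a b z - a * i) / (a * P) = -1 := by
      rw [Int.ediv_eq_iff_of_pos haP]
      constructor <;> linarith
    simp only [per, hq]
    have := hag (z + (0, -i)) (by
      rw [hh_add, hh_vert, abs_le]; constructor <;> linarith)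
    have e1 : z + (0, -i) + (0, i) = z := by ext <;> simp
    have e2 : z + (0, -i) + (0, i + P) = z + (0, -(P * -1)) := by ext <;> simp
    rw [e1, e2] at this
    exact this.symm
  rcases lt_or_ge (hh a b z) (a * i + a * P) with h' | h'
  · have hq : (hh a b z - a * i) / (a * P) = 0 := by
      rw [Int.ediv_eq_iff_of_pos haP]
      constructor <;> linarith
    simp only [per, hq]
    congr 1
    ext <;> simp
  · have hq : (hh a b z - a * i) / (a * P) = 1 := by
      rw [Int.ediv_eq_iff_of_pos haP]
      constructor <;> linarith
    simp only [per, hq]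
    have := hag (z + (0, -(i + P))) (by
      rw [hh_add, hh_vert, abs_le]; constructor <;> linarith)
    have e1 : z + (0, -(i + P)) + (0, i + P) = z := by ext <;> simp <;> ring
    have e2 : z + (0, -(i + P)) + (0, i) = z + (0, -(P * 1)) := by ext <;> simp <;> ring
    rw [e1, e2] at this
    exact this

theorem per_valid {T : Type} (τ : TilingSystem T) {c : ℤ × ℤ → T} {a b i P ρ : ℤ} (ha : 0 < a)
    (hP : ρ < P) (hρ0 : 0 ≤ ρ) (hρ : ∀ P ∈ τ.F, ∀ n ∈ P.support, |hh a b n| ≤ ρ)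
    (hc : τ.Valid c) (hag : Agree c a b ρ i (i + P)) : τ.Valid (per c a b i P) := by
  intro p hp u
  have hP0 : 0 < P := by linarith
  have haP : 0 < a * P := mul_pos ha hP0
  set m := (hh a b u - a * i) / (a * P) with hm
  obtain ⟨n, hn, hne⟩ := hc p hp (u + (0, P * (-m)))
  refine ⟨n, hn, ?_⟩
  have e1 : per c a b i P (n + u) = per c a b i P (n + (u + (0, P * (-m)))) := by
    rw [← add_assoc, per_vert c ha hP0]
  have h3 := abs_le.1 (hρ p hp n hn)
  have h4 := Int.mul_ediv_self_le (x := hh a b u - a * i) haP.ne'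
  have h5 := Int.lt_mul_ediv_self_add (x := hh a b u - a * i) haP
  rw [← hm] at h4 h5
  rw [e1, per_eq ha hP hρ0 hag]
  · exact hne
  · rw [hh_add, hh_add, hh_vert]
    have : a * (P * -m) = - (a * P * m) := by ring
    linarith
  · rw [hh_add, hh_add, hh_vert]
    have : a * (P * -m) = - (a * P * m) := by ring
    linarith

theorem pigeon {T : Type} [Finite T] {c : ℤ × ℤ → T} {a b : ℤ} (ha : 0 < a)
    (hw : IsPeriod c (a, b)) (ρ : ℤ) (hρ : 0 ≤ ρ) :
    ∃ N : ℕ, ∀ s : ℤ, ∃ i P : ℤ, s ≤ i ∧ ρ < P ∧ i + P ≤ s + N ∧ Agree c a b ρ i (i + P) := by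
  let B := ρ + |b| * a
  let Bx : Finset (ℤ × ℤ) := Finset.Icc 0 a ×ˢ Finset.Icc (-B) B
  let k := Nat.card (Bx → T)
  refine ⟨k * (ρ.toNat + 1), fun s => ?_⟩
  have : Fintype (Bx → T) := Fintype.ofFinite _
  let st : ℤ → (Bx → T) := fun j z => c (z.1 + (0, j))
  have key : ∀ i j, st i = st j → Agree c a b ρ i j := by
    intro i j hij z hz
    let z' : ℤ × ℤ := (z.1 % a, z.2 - z.1 / a * b)
    have hx0 := Int.emod_nonneg z.1 ha.ne'
    have hx1 := Int.emod_lt_of_pos z.1 ha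
    have hdm := Int.emod_add_mul_ediv z.1 a
    have hz' : hh a b z' = hh a b z := by
      simp only [hh, z']
      linear_combination -b * hdm
    have hmem : z' ∈ Bx := by
      simp only [Bx, Finset.mem_product, Finset.mem_Icc]
      refine ⟨⟨hx0, hx1.le⟩, ?_⟩
      have h1 := abs_le.1 hz
      rw [← hz'] at h1
      have hbx : |b * z'.1| ≤ |b| * a := by
        rw [abs_mul]
        exact mul_le_mul_of_nonneg_left (by rw [abs_of_nonneg hx0]; exact hx1.le) (abs_nonneg b)
      have hbx := abs_le.1 hbx
      have h3 : a * z'.2 = hh a b z' + b * z'.1 := by simp only [hh]; ring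
      have h4 : -B ≤ a * z'.2 := by simp only [B]; linarith
      have h5 : a * z'.2 ≤ B := by simp only [B]; linarith
      have hB : 0 ≤ B := by linarith
      constructor
      · by_contra h; nlinarith
      · by_contra h; nlinarith
    have tr : ∀ j, c (z + (0, j)) = c (z' + (0, j)) := by
      intro j
      apply eq_of_class ha hw
      · simp [z']
      · rw [hh_add, hh_add, hz']
    rw [tr, tr]
    exact congrFun hij ⟨z', hmem⟩
  obtain ⟨x, y, hxy, he⟩ := Fintype.exists_ne_map_eq_of_card_lt
    (fun m : Fin (k + 1) => st (s + (m : ℕ) * (ρ + 1))) (by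
      rw [Fintype.card_fin, ← Nat.card_eq_fintype_card]; exact Nat.lt_succ_self k)
  wlog hlt : x < y generalizing x y
  · exact this y x hxy.symm he.symm (lt_of_le_of_ne (not_lt.1 hlt) hxy.symm)
  have hx : (x : ℕ) < (y : ℕ) := hlt
  have hy : (y : ℕ) ≤ k := Nat.lt_succ_iff.1 y.2
  have hx' : ((x : ℕ) : ℤ) + 1 ≤ (y : ℕ) := by exact_mod_cast hx
  have hy' : ((y : ℕ) : ℤ) ≤ k := by exact_mod_cast hy
  have hx0 : (0 : ℤ) ≤ (x : ℕ) := by positivity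
  have hρc : (ρ.toNat : ℤ) = ρ := Int.toNat_of_nonneg hρ
  refine ⟨s + (x : ℕ) * (ρ + 1), ((y : ℕ) - (x : ℕ)) * (ρ + 1), ?_, ?_, ?_, ?_⟩
  · nlinarith
  · nlinarith
  · push_cast
    rw [hρc]
    nlinarith
  · apply key
    have : s + (x : ℕ) * (ρ + 1) + ((y : ℕ) - (x : ℕ)) * (ρ + 1) = s + ((y : ℕ) : ℤ) * (ρ + 1) := by
      ring
    rw [this]
    exact he

set_option maxHeartbeats 1000000 in
theorem exists_evper {T : Type} [Finite T] (τ : TilingSystem T) {c : ℤ × ℤ → T} {a b : ℤ}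
    (ha : 0 < a) {ρ : ℤ} (hρ0 : 0 ≤ ρ) (hρ : ∀ P ∈ τ.F, ∀ n ∈ P.support, |hh a b n| ≤ ρ)
    (hc : τ.Valid c) (hw : IsPeriod c (a, b)) (hno : ∀ m : ℤ, m ≠ 0 → ¬ IsPeriod c (0, m)) :
    ∃ (c' : ℤ × ℤ → T) (L : ℕ), 0 < L ∧ τ.Valid c' ∧ IsPeriod c' (a, b) ∧
      (∀ m : ℤ, m ≠ 0 → ¬ IsPeriod c' (0, m)) ∧
      (∀ z z' (m : ℤ), z' = z + (0, L * m) → hh a b z < - (a * L) → hh a b z' < - (a * L) →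
        c' z' = c' z) ∧
      (∀ z z' (m : ℤ), z' = z + (0, L * m) → a * L ≤ hh a b z → a * L ≤ hh a b z' →
        c' z' = c' z) := by
  obtain ⟨N, hN⟩ := pigeon ha hw ρ hρ0
  let D : ℤ := (N.factorial : ℕ)
  have hD : 0 < D := by
    have := Nat.factorial_pos N
    simp only [D]; exact_mod_cast this
  have haD : 0 < a * D := mul_pos ha hD
  obtain ⟨z0, hz0⟩ : ∃ z, c (z + (0, D)) ≠ c z := by
    have := hno D hD.ne'
    simpa [IsPeriod] using this
  obtain ⟨i, P, hi, hP, hiP, hag⟩ := hN (- |hh a b z0| - N)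
  obtain ⟨k, P', hk, hP', hkP', hag'⟩ := hN (|hh a b z0| + D + 1)
  have habs := neg_abs_le (hh a b z0)
  have habs' := le_abs_self (hh a b z0)
  have habs0 := abs_nonneg (hh a b z0)
  have hP0 : 0 < P := by linarith
  have hP'0 : 0 < P' := by linarith
  have hik : i + ρ < k := by linarith
  have haik : a * i + ρ < a * k := by nlinarith
  have hi0 : a * i ≤ hh a b z0 := by nlinarith
  have hk0 : hh a b z0 + a * D < a * k := by nlinarith
  let cD := per c a b i P
  let cU := per c a b k P'
  let c1 : ℤ × ℤ → T := fun z => if hh a b z < a * i then cD z else c z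
  let c' : ℤ × ℤ → T := fun z => if hh a b z < a * k then c1 z else cU z
  have v1 : τ.Valid c1 := by
    apply splice_valid τ hρ (per_valid τ ha hP hρ0 hρ hc hag) hc
    intro z h1 h2
    exact per_eq ha hP hρ0 hag z h1 (by nlinarith)
  have v' : τ.Valid c' := by
    apply splice_valid τ hρ v1 (per_valid τ ha hP' hρ0 hρ hc hag')
    intro z h1 h2
    rw [per_eq ha hP' hρ0 hag' z h1 (by nlinarith)]
    exact if_neg (by linarith)
  have low : ∀ z, hh a b z < a * i → c' z = cD z := by
    intro z hz
    simp only [c', c1]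
    rw [if_pos (by linarith), if_pos hz]
  have mid : ∀ z, a * i ≤ hh a b z → hh a b z < a * k → c' z = c z := by
    intro z hz hz'
    simp only [c', c1]
    rw [if_pos (by linarith), if_neg (by linarith)]
  have hig : ∀ z, a * k ≤ hh a b z → c' z = cU z := by
    intro z hz
    simp only [c']
    rw [if_neg (by linarith)]
  let L : ℕ := P.toNat * P'.toNat * (i.natAbs + k.natAbs + 1)
  have hPc : (P.toNat : ℤ) = P := Int.toNat_of_nonneg hP0.le
  have hP'c : (P'.toNat : ℤ) = P' := Int.toNat_of_nonneg hP'0.le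
  have hL : (L : ℤ) = P * P' * (|i| + |k| + 1) := by
    simp only [L]; push_cast; rw [hPc, hP'c]
  have hLge : |i| + |k| + 1 ≤ (L : ℤ) := by
    rw [hL]
    have : 1 ≤ P * P' := by nlinarith
    have := abs_nonneg i
    have := abs_nonneg k
    nlinarith
  have hLi : -(a * L) ≤ a * i := by
    have := neg_abs_le i
    have := abs_nonneg k
    nlinarith
  have hLk : a * k ≤ a * L := by
    have := le_abs_self k
    have := abs_nonneg i
    nlinarith
  refine ⟨c', L, ?_, v', ?_, ?_, ?_, ?_⟩
  · have := abs_nonneg i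
    have := abs_nonneg k
    have : (0 : ℤ) < L := by linarith
    exact_mod_cast this
  · intro z
    have h1 := per_w i P hw z
    have h2 := per_w k P' hw z
    have h3 := hw z
    simp only [c', c1, hh_add, hh_w, add_zero, cD, cU, h1, h2, h3]
  · intro m hm hper
    have all : ∀ z, c' z = cD z := by
      intro z
      let M : ℤ := - m * (|hh a b z| + |a * i| + 1)
      have e1 : c' (z + (0, P * (m * M))) = c' z := by
        have := IsPeriod.zmul hper (P * M) z
        rw [← this]
        congr 1
        ext <;> simp <;> ring
      have e2 : cD (z + (0, P * (m * M))) = cD z := per_vert c ha hP0 _ z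
      rw [← e1, ← e2]
      apply low
      rw [hh_add, hh_vert]
      have hm2 : 1 ≤ m * m := by
        rcases lt_or_gt_of_ne hm with h | h <;> nlinarith
      have q1 := le_abs_self (hh a b z)
      have q2 := neg_abs_le (a * i)
      have q3 : 0 ≤ |hh a b z| := abs_nonneg _
      have q4 := abs_nonneg (a * i)
      have haP : 1 ≤ a * P := by nlinarith
      have hamP : 1 ≤ a * P * (m * m) := by nlinarith
      have : a * (P * (m * M)) = - (a * P * (m * m) * (|hh a b z| + |a * i| + 1)) := by
        simp only [M]; ring
      rw [this]
      nlinarith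
    apply hz0
    obtain ⟨r, hr⟩ : P ∣ D := by
      rw [← hPc]
      simp only [D]
      have : P.toNat ∣ N.factorial := Nat.dvd_factorial (by omega) (by omega)
      exact_mod_cast this
    rw [← mid z0 hi0 (by linarith), ← mid (z0 + (0, D)) (by rw [hh_add, hh_vert]; linarith)
      (by rw [hh_add, hh_vert]; linarith), all, all, hr]
    exact per_vert c ha hP0 _ _
  · rintro z z' m rfl h1 h2
    rw [low _ (by linarith), low _ (by linarith)]
    have : (L : ℤ) * m = P * (P' * (|i| + |k| + 1) * m) := by rw [hL]; ring
    rw [this]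
    exact per_vert c ha hP0 _ _
  · rintro z z' m rfl h1 h2
    rw [hig _ (by linarith), hig _ (by linarith)]
    have : (L : ℤ) * m = P' * (P * (|i| + |k| + 1) * m) := by rw [hL]; ring
    rw [this]
    exact per_vert c ha hP'0 _ _

end SlopesRE
namespace SlopesRE

def red (Q : ℕ) (x : ℤ) : ℤ :=
  if x < 0 - (Q : ℤ) then x % (Q : ℤ) - 2 * (Q : ℤ) else if x < (Q : ℤ) then x else x % (Q : ℤ) + (Q : ℤ)

theorem red_spec {Q : ℕ} (hQ : 0 < Q) (x : ℤ) : ∃ m : ℤ, red Q x = x + Q * m ∧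
    ((x < -Q ∧ red Q x < -Q) ∨ (m = 0) ∨ (Q ≤ x ∧ Q ≤ red Q x)) ∧
    -(2 * Q) ≤ red Q x ∧ red Q x < 2 * Q := by
  have hQ' : (0 : ℤ) < Q := by exact_mod_cast hQ
  have h0 := Int.emod_nonneg x hQ'.ne'
  have h1 := Int.emod_lt_of_pos x hQ'
  have h2 := Int.emod_add_mul_ediv x Q
  unfold red
  split_ifs with h h'
  · exact ⟨- (x / Q) - 2, by linarith, Or.inl ⟨by linarith, by linarith⟩, by linarith, by linarith⟩
  · exact ⟨0, by ring, Or.inr (Or.inl rfl), by linarith, by linarith⟩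
  · exact ⟨- (x / Q) + 1, by linarith, Or.inr (Or.inr ⟨by linarith, by linarith⟩),
      by linarith, by linarith⟩

theorem red_low {Q : ℕ} (x : ℤ) (m : ℤ) (h : x < -Q) (h' : x + Q * m < -Q) :
    red Q (x + Q * m) = red Q x := by
  unfold red
  rw [if_pos (by linarith), if_pos (by linarith), Int.add_mul_emod_self_left]

theorem red_high {Q : ℕ} (x : ℤ) (m : ℤ) (h : Q ≤ x) (h' : Q ≤ x + Q * m) :
    red Q (x + Q * m) = red Q x := by
  have : (0 : ℤ) ≤ Q := by positivity
  unfold red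
  rw [if_neg (by linarith), if_neg (by linarith), if_neg (by linarith), if_neg (by linarith),
    Int.add_mul_emod_self_left]

abbrev Wit (T : Type) := (ℕ × ℤ) × (ℕ × List T)

def ev {T : Type} (d : T) (W : Wit T) (z : ℤ × ℤ) : T :=
  W.2.2.getD (Encodable.encode (z.1 % (W.1.1 : ℤ),
    red (W.1.1 * W.2.1) ((W.1.1 : ℤ) * z.2 - W.1.2 * z.1))) d

def bnd {T : Type} (R : ℕ) (W : Wit T) : ℕ :=
  2 * W.2.1 + R + (W.1.2.toNat + (-W.1.2).toNat) * (R + W.1.1)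

def ValidAt {T : Type} (τ : TilingSystem T) (c : ℤ × ℤ → T) (u : ℤ × ℤ) : Prop :=
  ∀ P ∈ τ.F, ∃ n ∈ P.support, c (n + u) ≠ P.data n

def Chk {T : Type} (τ : TilingSystem T) (R : ℕ) (d : T) (p : ℤ × ℤ)
    (X : Wit T × ((ℤ × ℤ) × ℕ)) : Prop :=
  0 < X.1.1.1 ∧ 0 < X.1.2.1 ∧ X.1.1.2 * p.1 = p.2 * (X.1.1.1 : ℤ) ∧
  (∀ i < X.1.1.1, ∀ j < 2 * bnd R X.1 + 1,
    ValidAt τ (ev d X.1) ((i : ℤ), (j : ℤ) - (bnd R X.1 : ℤ))) ∧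
  ((X.1.1.1 : ℤ) * X.2.1.2 - X.1.1.2 * X.2.1.1 < 0 - ((X.1.1.1 * X.1.2.1 : ℕ) : ℤ)) ∧
  ev d X.1 X.2.1 ≠ ev d X.1 (X.2.1.1, X.2.1.2 + ((X.1.2.1 * X.2.2 : ℕ) : ℤ))

theorem ev_eq {T : Type} (d : T) (a : ℕ) (b : ℤ) (L : ℕ) (l : List T) (z z' : ℤ × ℤ)
    (h1 : z.1 % (a : ℤ) = z'.1 % (a : ℤ)) (h2 : red (a * L) (hh a b z) = red (a * L) (hh a b z')) :
    ev d ((a, b), (L, l)) z = ev d ((a, b), (L, l)) z' := by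
  simp only [hh] at h2
  simp only [ev, h1, h2]

theorem ev_w {T : Type} (d : T) (a : ℕ) (b : ℤ) (L : ℕ) (l : List T) :
    IsPeriod (ev d ((a, b), (L, l))) ((a : ℤ), b) := by
  intro z
  apply ev_eq
  · simp
  · rw [hh_add, hh_w, add_zero]

theorem sound {T : Type} (τ : TilingSystem T) (R : ℕ) (d : T)
    (hR : ∀ P ∈ τ.F, ∀ n ∈ P.support, |n.1| ≤ R ∧ |n.2| ≤ R) (p : ℤ × ℤ)
    (X : Wit T × ((ℤ × ℤ) × ℕ)) (h : Chk τ R d p X) :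
    ∃ (a : ℕ) (b : ℤ), 0 < a ∧ b * p.1 = p.2 * a ∧
      ∃ c : ℤ × ℤ → T, τ.Valid c ∧ IsPeriod c (a, b) ∧ ∀ m : ℤ, m ≠ 0 → ¬ IsPeriod c (0, m) := by
  obtain ⟨⟨⟨a, b⟩, L, l⟩, z0, k⟩ := X
  obtain ⟨ha, hL, hab, hval, hz0, hne⟩ := h
  simp only at ha hL hab hval hz0 hne
  set c := ev d ((a, b), (L, l)) with hc
  have ha' : (0 : ℤ) < a := by exact_mod_cast ha
  have hL' : (0 : ℤ) < L := by exact_mod_cast hL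
  have hQ : ((a * L : ℕ) : ℤ) = a * L := by push_cast; ring
  have hw : IsPeriod c ((a : ℤ), b) := ev_w d a b L l
  have clow : ∀ z (m : ℤ), hh a b z < -(a * L) → hh a b z + a * L * m < - (a * L) →
      c (z + (0, L * m)) = c z := by
    intro z m h1 h2
    apply ev_eq
    · simp
    · rw [hh_add, hh_vert, ← mul_assoc, ← hQ]
      rw [← hQ] at h1 h2
      exact red_low _ _ h1 h2
  have chigh : ∀ z (m : ℤ), a * L ≤ hh a b z → a * L ≤ hh a b z + a * L * m →
      c (z + (0, L * m)) = c z := by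
    intro z m h1 h2
    apply ev_eq
    · simp
    · rw [hh_add, hh_vert, ← mul_assoc, ← hQ]
      rw [← hQ] at h1 h2
      exact red_high _ _ h1 h2
  refine ⟨a, b, ha, hab, c, ?_, hw, ?_⟩
  · -- validity
    set K := bnd R ((a, b), (L, l)) with hK
    have hKe : (K : ℤ) = 2 * L + R + |b| * (R + a) := by
      have : ((b.toNat : ℤ) + (-b).toNat) = |b| := by
        rcases abs_cases b with h | h <;> omega
      simp only [hK, bnd]
      push_cast
      rw [← this]
    have hb0 := abs_nonneg b
    have hbn : ∀ u : ℤ × ℤ, 0 ≤ u.1 → u.1 < a → ∀ P ∈ τ.F, ∀ n ∈ P.support,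
        a * (u.2 - R) - |b| * (R + a) ≤ hh a b (n + u) ∧
        hh a b (n + u) ≤ a * (u.2 + R) + |b| * (R + a) := by
      intro u h0 h1 P hP n hn
      obtain ⟨hn1, hn2⟩ := hR P hP n hn
      have hn2 := abs_le.1 hn2
      have : |b * (n.1 + u.1)| ≤ |b| * (R + a) := by
        rw [abs_mul]
        apply mul_le_mul_of_nonneg_left _ hb0
        refine (abs_add_le _ _).trans ?_
        rw [abs_of_nonneg h0]
        linarith
      have := abs_le.1 this
      simp only [hh, Prod.fst_add, Prod.snd_add]
      constructor <;> nlinarith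
    have hRn : (0 : ℤ) ≤ R := by positivity
    have hbR : 0 ≤ |b| * (R + a) := by positivity
    have main : ∀ N : ℕ, ∀ u : ℤ × ℤ, 0 ≤ u.1 → u.1 < a → |u.2| ≤ K + N → ValidAt τ c u := by
      intro N
      induction N with
      | zero =>
        rintro ⟨s, t⟩ h0 h1 h2
        have h2 := abs_le.1 h2
        simp only at h0 h1 h2
        have := hval s.toNat (by omega) (t + K).toNat (by omega)
        have e1 : (s.toNat : ℤ) = s := by omega
        have e2 : ((t + K).toNat : ℤ) - K = t := by omega
        rwa [e1, e2] at this
      | succ N ih =>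
        intro u h0 h1 h2
        by_cases h3 : |u.2| ≤ K + N
        · exact ih u h0 h1 h3
        push_cast at h2
        have hKa : |b| * (R + a) ≤ a * (|b| * (R + a)) := by nlinarith
        rcases le_or_gt 0 u.2 with hu | hu
        · rw [abs_of_nonneg hu] at h2 h3
          intro P hP
          obtain ⟨n, hn, hne⟩ := ih (u + (0, -(L : ℤ))) (by simpa using h0) (by simpa using h1) (by
            rw [abs_le]; simp only [Prod.snd_add]; constructor <;> linarith) P hP
          refine ⟨n, hn, ?_⟩
          have e : c (n + (u + (0, -(L : ℤ)))) = c (n + u) := by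
            have hb := (hbn u h0 h1 P hP n hn).1
            have : a * L ≤ hh a b (n + u) - a * L := by
              have : (a : ℤ) * (2 * L + |b| * (R + a)) ≤ a * (u.2 - R) :=
                mul_le_mul_of_nonneg_left (by linarith) ha'.le
              linarith
            have := chigh (n + u) (-1) (by nlinarith) (by linarith)
            rw [← this]
            congr 1
            ext <;> simp <;> ring
          rwa [← e]
        · rw [abs_of_neg hu] at h2 h3
          intro P hP
          obtain ⟨n, hn, hne⟩ := ih (u + (0, (L : ℤ))) (by simpa using h0) (by simpa using h1) (by
            rw [abs_le]; simp only [Prod.snd_add]; constructor <;> linarith) P hP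
          refine ⟨n, hn, ?_⟩
          have e : c (n + (u + (0, (L : ℤ)))) = c (n + u) := by
            have hb := (hbn u h0 h1 P hP n hn).2
            have : hh a b (n + u) + a * L < -(a * L) := by
              have : (a : ℤ) * (u.2 + R) < a * (-(2 * L + |b| * (R + a))) :=
                mul_lt_mul_of_pos_left (by linarith) ha'
              linarith
            have := clow (n + u) 1 (by nlinarith) (by linarith)
            rw [← this]
            congr 1
            ext <;> simp <;> ring
          rwa [← e]
    intro P hP u
    have hx0 := Int.emod_nonneg u.1 ha'.ne'
    have hx1 := Int.emod_lt_of_pos u.1 ha'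
    have hdm := Int.emod_add_mul_ediv u.1 a
    obtain ⟨n, hn, hne⟩ := main (u.2 - u.1 / a * b).natAbs (u.1 % a, u.2 - u.1 / a * b) hx0 hx1
      (by simp only [Int.natCast_natAbs]; linarith [abs_nonneg b]) P hP
    refine ⟨n, hn, ?_⟩
    have : c (n + u) = c (n + (u.1 % a, u.2 - u.1 / a * b)) := by
      apply eq_of_class ha' hw
      · simp
      · rw [hh_add, hh_add]
        congr 1
        simp only [hh]
        linear_combination b * hdm
    rwa [this]
  · intro m hm hper
    apply hne
    have hz0' : hh a b z0 < -(a * L) := by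
      simp only [hh]; rw [← hQ]; linarith
    let M : ℤ := - m * (m * m) * k
    -- choose a large multiple
    have e1 : c (z0 + (0, L * (k - m * m * k))) = c z0 := by
      have hm2 : 1 ≤ m * m := by
        rcases lt_or_gt_of_ne hm with h | h <;> nlinarith
      have hk : (0 : ℤ) ≤ k := by positivity
      have haL : 0 < (a : ℤ) * L := mul_pos ha' hL'
      apply clow _ _ hz0'
      have : (k : ℤ) - m * m * k ≤ 0 := by nlinarith
      nlinarith
    have e2 := IsPeriod.zmul hper (L * (m * k)) (z0 + (0, L * (k - m * m * k)))
    rw [← e1, ← e2]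
    congr 1
    ext
    · simp
    · simp; ring

theorem complete {T : Type} [Finite T] (τ : TilingSystem T) (R : ℕ) (d : T)
    (hR : ∀ P ∈ τ.F, ∀ n ∈ P.support, |n.1| ≤ R ∧ |n.2| ≤ R) (p : ℤ × ℤ)
    (h : ∃ (a : ℕ) (b : ℤ), 0 < a ∧ b * p.1 = p.2 * a ∧
      ∃ c : ℤ × ℤ → T, τ.Valid c ∧ IsPeriod c (a, b) ∧ ∀ m : ℤ, m ≠ 0 → ¬ IsPeriod c (0, m)) :
    ∃ X : Wit T × ((ℤ × ℤ) × ℕ), Chk τ R d p X := by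
  classical
  obtain ⟨a, b, ha, hab, c0, hc0, hw0, hno0⟩ := h
  have ha' : (0 : ℤ) < a := by exact_mod_cast ha
  have hρ : ∀ P ∈ τ.F, ∀ n ∈ P.support, |hh a b n| ≤ (a * R + |b| * R : ℤ) := by
    intro P hP n hn
    obtain ⟨h1, h2⟩ := hR P hP n hn
    simp only [hh]
    refine (abs_sub _ _).trans ?_
    rw [abs_mul, abs_mul, abs_of_pos ha']
    exact add_le_add (mul_le_mul_of_nonneg_left h2 ha'.le)
      (mul_le_mul_of_nonneg_left h1 (abs_nonneg b))
  obtain ⟨c, L, hL, hc, hw, hno, hlow, hhigh⟩ :=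
    exists_evper τ ha' (by positivity) hρ hc0 hw0 hno0
  have hL' : (0 : ℤ) < L := by exact_mod_cast hL
  have hQ : ((a * L : ℕ) : ℤ) = a * L := by push_cast; ring
  have hQ0 : 0 < a * L := Nat.mul_pos ha hL
  let val : ℤ × ℤ → T := fun y =>
    if h : ∃ z : ℤ × ℤ, z.1 % (a : ℤ) = y.1 ∧ hh a b z = y.2 then c h.choose else d
  obtain ⟨B, hB⟩ : ∃ B : ℕ, ∀ y : ℤ × ℤ, 0 ≤ y.1 → y.1 < a → -(2 * (a * L : ℕ)) ≤ y.2 →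
      y.2 < 2 * (a * L : ℕ) → Encodable.encode y < B := by
    let S : Finset (ℤ × ℤ) := Finset.Ico 0 (a : ℤ) ×ˢ
      Finset.Ico (-(2 * ((a * L : ℕ) : ℤ))) (2 * ((a * L : ℕ) : ℤ))
    refine ⟨S.sup Encodable.encode + 1, fun y h1 h2 h3 h4 => Nat.lt_succ_of_le ?_⟩
    apply Finset.le_sup (f := Encodable.encode)
    simp only [S, Finset.mem_product, Finset.mem_Ico]
    exact ⟨⟨h1, h2⟩, h3, h4⟩
  let l : List T := (List.range B).map fun m =>
    match Encodable.decode (α := ℤ × ℤ) m with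
    | some y => val y
    | none => d
  have hev : ev d ((a, b), (L, l)) = c := by
    funext z
    obtain ⟨m, hm, hcase, hr1, hr2⟩ := red_spec hQ0 (hh a b z)
    have hx0 := Int.emod_nonneg z.1 ha'.ne'
    have hx1 := Int.emod_lt_of_pos z.1 ha'
    have hlt := hB (z.1 % a, red (a * L) (hh a b z)) hx0 hx1 hr1 hr2
    have e1 : ev d ((a, b), (L, l)) z = val (z.1 % a, red (a * L) (hh a b z)) := by
      change l.getD (Encodable.encode (z.1 % (a : ℤ), red (a * L) (hh a b z))) d = _
      rw [List.getD_eq_getElem?_getD]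
      simp only [l, List.getElem?_map, List.getElem?_range hlt, Option.map_some,
        Encodable.encodek, Option.getD_some]
    rw [e1]
    let z' : ℤ × ℤ := z + (0, L * m)
    have hz' : hh a b z' = red (a * L) (hh a b z) := by
      simp only [z']
      rw [hh_add, hh_vert, hm, hQ]; ring
    have hex : ∃ y : ℤ × ℤ, y.1 % (a : ℤ) = z.1 % a ∧ hh a b y = red (a * L) (hh a b z) :=
      ⟨z', by simp [z'], hz'⟩
    have e2 : val (z.1 % a, red (a * L) (hh a b z)) = c hex.choose := dif_pos hex
    have hs := hex.choose_spec
    have e3 : c hex.choose = c z' :=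
      eq_of_class ha' hw (by rw [hs.1]; simp [z']) (by rw [hs.2, hz'])
    rw [e2, e3]
    rw [← hz', hQ] at hcase
    rcases hcase with ⟨h1, h2⟩ | h1 | ⟨h1, h2⟩
    · exact hlow z z' m rfl h1 h2
    · simp only [z', h1, mul_zero]
      congr 1
      ext <;> simp
    · exact hhigh z z' m rfl h1 h2
  obtain ⟨z0, k, hz0, hk⟩ : ∃ (z0 : ℤ × ℤ) (k : ℕ), hh a b z0 < -(a * L) ∧
      c z0 ≠ c (z0.1, z0.2 + ((L * k : ℕ) : ℤ)) := by
    by_contra hcon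
    push Not at hcon
    apply hno L hL'.ne'
    intro z
    obtain ⟨k, hk⟩ : ∃ k : ℕ, hh a b z - a * L * k < -(a * L) := by
      refine ⟨(hh a b z).natAbs + 2, ?_⟩
      push_cast
      have haL : 1 ≤ (a : ℤ) * L := by exact_mod_cast hQ0
      have := le_abs_self (hh a b z)
      have := abs_nonneg (hh a b z)
      nlinarith
    have hlo : hh a b (z + (0, -((L : ℤ) * k))) < -(a * L) := by
      rw [hh_add, hh_vert]; linarith
    have e1 := hcon (z + (0, -((L : ℤ) * k))) k hlo
    have e2 := hcon (z + (0, -((L : ℤ) * k))) (k + 1) hlo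
    rw [e1] at e2
    convert e2.symm using 2
    · ext <;> simp <;> ring
    · ext <;> simp
  refine ⟨(((a, b), (L, l)), (z0, k)), ha, hL, hab, ?_, ?_, ?_⟩
  · simp only [hev]
    intro i _ j _ P hP
    exact hc P hP _
  · simp only [hh] at hz0
    simp only [hQ]
    linarith
  · simp only [hev]
    exact hk

theorem prim_finset {α ι : Type} [Primcodable α] (s : Set ι) (hs : s.Finite) (p : ι → α → Prop)
    (h : ∀ x ∈ s, PrimrecPred (p x)) : PrimrecPred (fun a => ∀ x ∈ s, p x a) := by
  classical
  induction s, hs using Set.Finite.induction_on with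
  | empty =>
    refine PrimrecPred.of_eq (p := fun _ : α => (0 : ℕ) = 0)
      (Primrec.eq.comp (Primrec.const 0) (Primrec.const 0)) (by simp)
  | @insert x s _ _ ih =>
    refine PrimrecPred.of_eq ((h x (by simp)).and (ih fun y hy => h y (by simp [hy]))) ?_
    intro a
    simp

theorem prim_red : Primrec₂ red := by
  have hx : Primrec (fun p : ℕ × ℤ => p.2) := Primrec.snd
  have hQ : Primrec (fun p : ℕ × ℤ => (p.1 : ℤ)) := prim_ofNat.comp Primrec.fst
  have hm : Primrec (fun p : ℕ × ℤ => p.2 % (p.1 : ℤ)) := prim_emod.comp Primrec.snd Primrec.fst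
  refine Primrec.ite ?_ ?_ (Primrec.ite ?_ ?_ ?_)
  · exact prim_lt.comp hx (prim_sub.comp (Primrec.const 0) hQ)
  · exact prim_sub.comp hm (prim_mul.comp (Primrec.const 2) hQ)
  · exact prim_lt.comp hx hQ
  · exact hx
  · exact prim_add.comp hm hQ

theorem prim_ev {T : Type} [Primcodable T] (d : T) : Primrec₂ (ev d) := by
  have hz1 : Primrec (fun p : Wit T × (ℤ × ℤ) => p.2.1) := Primrec.fst.comp Primrec.snd
  have hz2 : Primrec (fun p : Wit T × (ℤ × ℤ) => p.2.2) := Primrec.snd.comp Primrec.snd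
  have ha : Primrec (fun p : Wit T × (ℤ × ℤ) => p.1.1.1) :=
    Primrec.fst.comp (Primrec.fst.comp Primrec.fst)
  have hb : Primrec (fun p : Wit T × (ℤ × ℤ) => p.1.1.2) :=
    Primrec.snd.comp (Primrec.fst.comp Primrec.fst)
  have hL : Primrec (fun p : Wit T × (ℤ × ℤ) => p.1.2.1) :=
    Primrec.fst.comp (Primrec.snd.comp Primrec.fst)
  have hl : Primrec (fun p : Wit T × (ℤ × ℤ) => p.1.2.2) :=
    Primrec.snd.comp (Primrec.snd.comp Primrec.fst)
  refine (Primrec.list_getD d).comp hl (Primrec.encode.comp (Primrec.pair ?_ ?_))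
  · exact prim_emod.comp hz1 ha
  · exact prim_red.comp (Primrec.nat_mul.comp ha hL)
      (prim_sub.comp (prim_mul.comp (prim_ofNat.comp ha) hz2) (prim_mul.comp hb hz1))

theorem prim_bnd {T : Type} [Primcodable T] (R : ℕ) : Primrec (bnd (T := T) R) := by
  have ha : Primrec (fun p : Wit T => p.1.1) := Primrec.fst.comp Primrec.fst
  have hb : Primrec (fun p : Wit T => p.1.2) := Primrec.snd.comp Primrec.fst
  have hL : Primrec (fun p : Wit T => p.2.1) := Primrec.fst.comp Primrec.snd
  exact Primrec.nat_add.comp (Primrec.nat_add.comp (Primrec.nat_mul.comp (Primrec.const 2) hL)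
    (Primrec.const R)) (Primrec.nat_mul.comp (Primrec.nat_add.comp (prim_toNat.comp hb)
      (prim_negToNat.comp hb)) (Primrec.nat_add.comp (Primrec.const R) ha))

theorem prim_validAt {T : Type} [Primcodable T] (τ : TilingSystem T) (d : T) :
    PrimrecPred (fun q : Wit T × (ℤ × ℤ) => ValidAt τ (ev d q.1) q.2) := by
  unfold ValidAt
  apply prim_finset τ.F τ.finite (fun P (q : Wit T × (ℤ × ℤ)) =>
    ∃ n ∈ P.support, ev d q.1 (n + q.2) ≠ P.data n)
  intro P _
  have : PrimrecPred (fun q : Wit T × (ℤ × ℤ) => ∀ n ∈ (P.support : Set (ℤ × ℤ)),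
      ev d q.1 (n + q.2) = P.data n) := by
    apply prim_finset _ (Finset.finite_toSet _) (fun n (q : Wit T × (ℤ × ℤ)) =>
      ev d q.1 (n + q.2) = P.data n)
    intro n _
    refine Primrec.eq.comp ((prim_ev d).comp Primrec.fst (Primrec.pair ?_ ?_)) (Primrec.const _)
    · exact prim_add.comp (Primrec.const n.1) (Primrec.fst.comp Primrec.snd)
    · exact prim_add.comp (Primrec.const n.2) (Primrec.snd.comp Primrec.snd)
  refine PrimrecPred.of_eq this.not ?_
  intro q
  simp

theorem prim_forall_lt {β : Type} [Primcodable β] {R : ℕ → β → Prop} (hf : PrimrecRel R) :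
    PrimrecRel fun n y => ∀ x < n, R x y :=
  PrimrecPred.of_eq (hf.forall_mem_list.comp (Primrec.list_range.comp Primrec.fst) Primrec.snd)
    (by simp)

theorem prim_chk {T : Type} [Primcodable T] (τ : TilingSystem T) (R : ℕ) (d : T) :
    PrimrecRel (Chk τ R d) := by
  let A := (ℤ × ℤ) × (Wit T × ((ℤ × ℤ) × ℕ))
  have hp1 : Primrec (fun q : A => q.1.1) := Primrec.fst.comp Primrec.fst
  have hp2 : Primrec (fun q : A => q.1.2) := Primrec.snd.comp Primrec.fst
  have hX : Primrec (fun q : A => q.2) := Primrec.snd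
  have hW : Primrec (fun q : A => q.2.1) := Primrec.fst.comp hX
  have ha : Primrec (fun q : A => q.2.1.1.1) := Primrec.fst.comp (Primrec.fst.comp hW)
  have hb : Primrec (fun q : A => q.2.1.1.2) := Primrec.snd.comp (Primrec.fst.comp hW)
  have hL : Primrec (fun q : A => q.2.1.2.1) := Primrec.fst.comp (Primrec.snd.comp hW)
  have hz : Primrec (fun q : A => q.2.2.1) := Primrec.fst.comp (Primrec.snd.comp hX)
  have hz1 : Primrec (fun q : A => q.2.2.1.1) := Primrec.fst.comp hz
  have hz2 : Primrec (fun q : A => q.2.2.1.2) := Primrec.snd.comp hz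
  have hk : Primrec (fun q : A => q.2.2.2) := Primrec.snd.comp (Primrec.snd.comp hX)
  have haz : Primrec (fun q : A => (q.2.1.1.1 : ℤ)) := prim_ofNat.comp ha
  refine PrimrecPred.and ?_ (PrimrecPred.and ?_ (PrimrecPred.and ?_ (PrimrecPred.and ?_
    (PrimrecPred.and ?_ ?_))))
  · exact Primrec.nat_lt.comp (Primrec.const 0) ha
  · exact Primrec.nat_lt.comp (Primrec.const 0) hL
  · exact Primrec.eq.comp (prim_mul.comp hb hp1) (prim_mul.comp hp2 haz)
  · have r0 : PrimrecRel (fun (j : ℕ) (y : ℕ × Wit T) =>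
        ValidAt τ (ev d y.2) ((y.1 : ℤ), (j : ℤ) - (bnd R y.2 : ℤ))) := by
      refine (prim_validAt τ d).comp (Primrec.pair (Primrec.snd.comp Primrec.snd)
        (Primrec.pair ?_ ?_))
      · exact prim_ofNat.comp (Primrec.fst.comp Primrec.snd)
      · exact prim_sub.comp (prim_ofNat.comp Primrec.fst)
          (prim_ofNat.comp ((prim_bnd R).comp (Primrec.snd.comp Primrec.snd)))
    have r1 := prim_forall_lt r0
    have r2 : PrimrecRel (fun (i : ℕ) (W : Wit T) => ∀ j < 2 * bnd R W + 1,
        ValidAt τ (ev d W) ((i : ℤ), (j : ℤ) - (bnd R W : ℤ))) := by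
      refine r1.comp (f := fun y : ℕ × Wit T => 2 * bnd R y.2 + 1) (g := fun y => y) ?_ Primrec.id
      exact Primrec.succ.comp (Primrec.nat_mul.comp (Primrec.const 2)
        ((prim_bnd R).comp Primrec.snd))
    exact (prim_forall_lt r2).comp ha hW
  · exact prim_lt.comp (prim_sub.comp (prim_mul.comp haz hz2) (prim_mul.comp hb hz1))
      (prim_sub.comp (Primrec.const 0) (prim_ofNat.comp (Primrec.nat_mul.comp ha hL)))
  · refine PrimrecPred.not (Primrec.eq.comp ((prim_ev d).comp hW hz) ((prim_ev d).comp hW ?_))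
    exact Primrec.pair hz1 (prim_add.comp hz2 (prim_ofNat.comp (Primrec.nat_mul.comp hL hk)))

theorem exists_R {T : Type} (τ : TilingSystem T) :
    ∃ R : ℕ, ∀ P ∈ τ.F, ∀ n ∈ P.support, |n.1| ≤ R ∧ |n.2| ≤ R := by
  have hfin : (⋃ P ∈ τ.F, (P.support : Set (ℤ × ℤ))).Finite :=
    τ.finite.biUnion fun P _ => Finset.finite_toSet _
  refine ⟨hfin.toFinset.sup (fun n => n.1.natAbs + n.2.natAbs), fun P hP n hn => ?_⟩
  have hle : n.1.natAbs + n.2.natAbs ≤ hfin.toFinset.sup (fun n => n.1.natAbs + n.2.natAbs) := by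
    apply Finset.le_sup (f := fun n : ℤ × ℤ => n.1.natAbs + n.2.natAbs)
    rw [Set.Finite.mem_toFinset]
    simp only [Set.mem_iUnion]
    exact ⟨P, hP, hn⟩
  rw [← Int.natCast_natAbs, ← Int.natCast_natAbs]
  constructor <;> norm_cast <;> omega

end SlopesRE

/-- The set of slopes of any tiling system is recursively enumerable: some partial
computable function (Turing machine) halts on `(p, q) ≠ (0, 0)` iff `q/p` is a slope. -/
theorem slopes_re {T : Type} [Finite T] (τ : TilingSystem T) :
    ∃ f : ℤ × ℤ →. Unit, Partrec f ∧
      ∀ p : ℤ × ℤ, p ≠ 0 → ((f p).Dom ↔ dir p ∈ τ.Slopes) := by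
  classical
  rcases isEmpty_or_nonempty T with hT | ⟨⟨d⟩⟩
  · refine ⟨fun _ => Part.none, Partrec.none, fun p _ => ?_⟩
    constructor
    · intro h; exact h.elim
    · rintro ⟨c, -⟩
      exact (hT.false (c 0)).elim
  obtain ⟨k, ⟨e⟩⟩ := Finite.exists_equiv_fin T
  letI : Primcodable T := Primcodable.ofEquiv (Fin k) e
  obtain ⟨R, hR⟩ := SlopesRE.exists_R τ
  obtain ⟨f, hf, hdom⟩ := SlopesRE.re_exists (SlopesRE.prim_chk τ R d)
  have hmain : ∀ p : ℤ × ℤ, p.1 ≠ 0 → ((f p).Dom ↔ dir p ∈ τ.Slopes) := by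
    intro p hp
    rw [hdom, SlopesRE.slope_iff τ p hp]
    exact ⟨fun ⟨X, hX⟩ => SlopesRE.sound τ R d hR p X hX, SlopesRE.complete τ R d hR p⟩
  let g : Part Unit := if none ∈ τ.Slopes then Part.some () else Part.none
  have hg : Partrec (fun _ : ℤ × ℤ => g) := by
    by_cases h : none ∈ τ.Slopes
    · simp only [g, if_pos h]
      exact (Computable.const ()).partrec
    · simp only [g, if_neg h]
      exact Partrec.none
  have hc : Computable (fun p : ℤ × ℤ => decide (p.1 = 0)) :=
    (PrimrecPred.decide (Primrec.eq.comp Primrec.fst (Primrec.const 0))).to_comp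
  refine ⟨fun p => cond (decide (p.1 = 0)) g (f p), Partrec.cond hc hg hf, fun p _ => ?_⟩
  by_cases hp : p.1 = 0
  · have hd : dir p = none := by simp [dir, hp]
    rw [hd]
    by_cases h : none ∈ τ.Slopes
    · simp [hp, g, h]
    · simp [hp, g, h]
  · simp only [hp, decide_false, cond_false]
    exact hmain p hp
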